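/- Let p be a prime. Define S(p) = { j ∈ [0, p-1] : m(3m-1)/2 ≡ j (mod p) for some integer m } and T(p) = { k ∈ [0, p-1] : k is strictly larger than every element of S(p) }. Then for every i ∈ T(p) and every n ≥ 0, the Fishburn number ξ(pn + i) is divisible by p. -/

import Mathlib

open Polynomial Finset

/-- The Fishburn numbers: ξ(n) is the coefficient of q^n in
∑_{j=0}^{n} ∏_{i=1}^{j} (1 - (1-q)^i). -/
noncomputable def fishburn (n : ℕ) : ℤ :=
  (∑ j ∈ Finset.range (n + 1), ∏ i ∈ Finset.range j, (1 - (1 - X) ^ (i + 1)) : Polynomial ℤ).coeff n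

section FunctionalEquation

variable {R : Type*} [CommRing R]

/-- The `q`-Pochhammer product `(xq; q)_n`. -/
def qPoch (x q : R) (n : ℕ) : R := ∏ i ∈ range n, (1 - x * q ^ (i + 1))

lemma qPoch_succ (x q : R) (n : ℕ) :
    qPoch x q (n + 1) = qPoch x q n * (1 - x * q ^ (n + 1)) :=
  prod_range_succ _ _

lemma qPoch_succ' (x q : R) (n : ℕ) :
    qPoch x q (n + 1) = qPoch (q * x) q n * (1 - x * q) := by
  unfold qPoch
  rw [prod_range_succ']
  congr 1
  · exact prod_congr rfl fun i _ => by ring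
  · ring

lemma qPoch_mul_left {q : R} {P : ℕ} (hP : 0 < P) (hq : q ^ P = 1) (x : R) :
    qPoch (q * x) q P = qPoch x q P := by
  obtain ⟨m, rfl⟩ : ∃ m, P = m + 1 := ⟨P - 1, by omega⟩
  rw [qPoch_succ, qPoch_succ', hq]
  ring

/-- The truncation of Zagier's series `∑ (x; q)_{k+1} x^k`. -/
def zagierSum (x q : R) (n : ℕ) : R := (1 - x) * ∑ k ∈ range n, qPoch x q k * x ^ k

lemma zagierSum_mul_left_aux (x q : R) (n : ℕ) :
    q ^ 2 * x ^ 3 * ∑ k ∈ range n, qPoch x q (k + 1) * (q * x) ^ k =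
      -zagierSum x q n + 1 - q * x ^ 2
        + x ^ n * (qPoch x q n * (x - 1) - x * qPoch x q (n + 1)) := by
  unfold zagierSum
  induction n with
  | zero => simp [qPoch]; ring
  | succ n ih =>
    rw [sum_range_succ, mul_add, ih, sum_range_succ, qPoch_succ x q (n + 1), qPoch_succ x q n]
    ring

lemma zagierSum_eq {q : R} {P : ℕ} (hq : q ^ P = 1) (x : R) :
    zagierSum x q P = (1 - q * x ^ 2) * (1 - x ^ P * qPoch x q P)
      - q ^ 2 * x ^ 3 * zagierSum (q * x) q P := by
  have h := zagierSum_mul_left_aux x q P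
  have h2 : zagierSum (q * x) q P = ∑ k ∈ range P, qPoch x q (k + 1) * (q * x) ^ k := by
    unfold zagierSum
    rw [mul_sum]
    exact sum_congr rfl fun k _ => by rw [qPoch_succ']; ring
  rw [h2, h, qPoch_succ, pow_succ q P, hq]
  ring

/-- The pentagonal numbers of the second kind `k(3k+1)/2`, written as a sum. -/
def secondPentagonal (k : ℕ) : ℕ := ∑ j ∈ range k, (3 * j + 2)

lemma two_mul_secondPentagonal (k : ℕ) : 2 * secondPentagonal k = k * (3 * k + 1) := by
  unfold secondPentagonal
  induction k with
  | zero => simp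
  | succ k ih => rw [sum_range_succ, mul_add, ih]; ring

lemma secondPentagonal_succ (k : ℕ) : secondPentagonal (k + 1) = secondPentagonal k + (3 * k + 2) :=
  sum_range_succ _ _

lemma dvd_secondPentagonal {P : ℕ} (hP : Odd P) : P ∣ secondPentagonal P :=
  (Nat.coprime_two_right.mpr hP).dvd_of_dvd_mul_left ⟨_, two_mul_secondPentagonal P⟩

lemma zagierSum_iterate {q : R} {P : ℕ} (hP : 0 < P) (hq : q ^ P = 1) (x : R) (K : ℕ) :
    zagierSum x q P = (1 - x ^ P * qPoch x q P) *
        ∑ k ∈ range K, (-1) ^ k * q ^ secondPentagonal k * x ^ (3 * k) * (1 - q ^ (2 * k + 1) * x ^ 2)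
      + (-1) ^ K * q ^ secondPentagonal K * x ^ (3 * K) * zagierSum (q ^ K * x) q P := by
  have hW : ∀ k, qPoch (q ^ k * x) q P = qPoch x q P := by
    intro k
    induction k with
    | zero => simp
    | succ k ih => rw [pow_succ', mul_assoc, qPoch_mul_left hP hq, ih]
  induction K with
  | zero => simp [secondPentagonal]
  | succ K ih =>
    have h := zagierSum_eq hq (q ^ K * x)
    rw [hW, mul_pow _ _ P, pow_right_comm, hq, one_pow, one_mul, ← mul_assoc q,
      ← pow_succ'] at h
    rw [ih, h, sum_range_succ, secondPentagonal_succ]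
    ring

lemma zagierSum_mul_one_add {q : R} {P : ℕ} (hP : Odd P) (hq : q ^ P = 1) (x : R) :
    zagierSum x q P * (1 + x ^ (3 * P)) = (1 - x ^ P * qPoch x q P) *
        ∑ k ∈ range P,
          (-1) ^ k * q ^ secondPentagonal k * x ^ (3 * k) * (1 - q ^ (2 * k + 1) * x ^ 2) := by
  have h := zagierSum_iterate hP.pos hq x P
  obtain ⟨c, hc⟩ := dvd_secondPentagonal hP
  rw [hc, pow_mul, hq, hP.neg_one_pow, one_pow, one_mul] at h
  linear_combination h

/-- A finite form of Zagier's strange identity at a `P`-th root of unity, `P` odd. -/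
theorem two_mul_sum_qPoch {q : R} {P : ℕ} (hP : Odd P) (hq : q ^ P = 1) :
    2 * ∑ k ∈ range P, qPoch 1 q k =
      ∑ k ∈ range P, (-1) ^ k *
        ((3 * k + 2) * q ^ (secondPentagonal k + (2 * k + 1)) - 3 * k * q ^ secondPentagonal k) := by
  have h := zagierSum_mul_one_add (R := R[X]) (q := C q) hP (by rw [← C_pow, hq, C_1]) X
  unfold zagierSum at h
  set B : R[X] := ∑ k ∈ range P, (-1) ^ k * C q ^ secondPentagonal k * X ^ (3 * k) *
    (1 - C q ^ (2 * k + 1) * X ^ 2) with hB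
  set G : R[X] := ∑ k ∈ range P, qPoch X (C q) k * X ^ k with hG
  have hW : eval 1 (qPoch X (C q) P) = 0 := by
    rw [qPoch, eval_prod]
    refine prod_eq_zero (i := P - 1) (mem_range.mpr (Nat.sub_lt hP.pos one_pos)) ?_
    rw [show P - 1 + 1 = P from Nat.sub_add_cancel hP.pos, ← C_pow, hq]
    simp
  have hB0 : eval 1 B = 0 := by
    have := congrArg (eval 1) h
    simpa [hW] using this.symm
  have hG1 : eval 1 G = ∑ k ∈ range P, qPoch 1 q k := by
    simp [hG, eval_finsetSum, qPoch, eval_prod]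
  have hB1 : eval 1 (derivative B) = -∑ k ∈ range P, (-1) ^ k *
        ((3 * k + 2) * q ^ (secondPentagonal k + (2 * k + 1)) - 3 * k * q ^ secondPentagonal k) := by
    rw [hB, derivative_sum, eval_finsetSum, ← sum_neg_distrib]
    refine sum_congr rfl fun k _ => ?_
    have : (-1 : R[X]) ^ k * C q ^ secondPentagonal k * X ^ (3 * k) * (1 - C q ^ (2 * k + 1) * X ^ 2)
        = C ((-1) ^ k * q ^ secondPentagonal k) * X ^ (3 * k)
          - C ((-1) ^ k * q ^ (secondPentagonal k + (2 * k + 1))) * X ^ (3 * k + 2) := by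
      simp only [C_mul, C_pow, C_neg, C_1]
      ring
    rw [this, derivative_sub, derivative_C_mul_X_pow, derivative_C_mul_X_pow]
    simp
    ring
  have hd := congrArg (fun f => eval 1 (derivative f)) h
  simp only [derivative_mul, eval_add, eval_mul, hB0, hB1, mul_zero, zero_add] at hd
  simp [hW, hG1] at hd
  linear_combination hd

end FunctionalEquation

lemma coeff_sum_eq_of_le {R : Type*} [CommRing R] {m P : ℕ} (h : m < P) :
    (∑ j ∈ range P, ∏ i ∈ range j, (1 - (1 - X) ^ (i + 1)) : R[X]).coeff m =
      (∑ j ∈ range (m + 1), ∏ i ∈ range j, (1 - (1 - X) ^ (i + 1)) : R[X]).coeff m := by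
  rw [finsetSum_coeff, finsetSum_coeff]
  refine (sum_subset (range_subset_range.mpr h) fun j _ hj => ?_).symm
  have hdvd : (X : R[X]) ^ j ∣ ∏ i ∈ range j, (1 - (1 - X) ^ (i + 1)) := by
    have := prod_dvd_prod_of_dvd (s := range j) (fun _ => (X : R[X]))
      (fun i => 1 - (1 - X) ^ (i + 1)) fun i _ => by
        have h := sub_dvd_pow_sub_pow (1 : R[X]) (1 - X) (i + 1)
        rwa [one_pow, show (1 : R[X]) - (1 - X) = X by ring] at h
    simpa using this
  exact X_pow_dvd_iff.mp hdvd m (by simpa using hj)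

lemma coeff_one_sub_X_pow_eq_zero {p : ℕ} [Fact p.Prime] {e m : ℕ} (h : e % p < m % p) :
    ((1 - X : (ZMod p)[X]) ^ e).coeff m = 0 := by
  have h1 : (1 - X : (ZMod p)[X]) = -(X + C (-1)) := by
    rw [C_neg, C_1]
    ring
  have h2 : ((e.choose m : ℕ) : ZMod p) = 0 := by
    have := (ZMod.natCast_eq_natCast_iff _ _ _).mpr
      (Choose.choose_modEq_choose_mod_mul_choose_div_nat (n := e) (k := m) (p := p))
    rw [this, Nat.choose_eq_zero_of_lt h, zero_mul, Nat.cast_zero]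
  rw [h1, neg_pow, ← C_1, ← C_neg, ← C_pow, coeff_C_mul, coeff_X_add_C_pow, h2, mul_zero, mul_zero]

lemma X_pow_dvd_two_mul_sum {p : ℕ} [Fact p.Prime] (hp : Odd p) (r : ℕ) :
    (X : (ZMod p)[X]) ^ p ^ r ∣
      2 * ∑ j ∈ range (p ^ r), ∏ i ∈ range j, (1 - (1 - X) ^ (i + 1)) -
        ∑ k ∈ range (p ^ r), (-1) ^ k *
          ((3 * (k : (ZMod p)[X]) + 2) * (1 - X) ^ (secondPentagonal k + (2 * k + 1))
            - 3 * (k : (ZMod p)[X]) * (1 - X) ^ secondPentagonal k) := by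
  rw [← Ideal.Quotient.eq_zero_iff_dvd]
  set φ := Ideal.Quotient.mk (Ideal.span {(X : (ZMod p)[X]) ^ p ^ r})
  have hq : φ (1 - X) ^ p ^ r = 1 := by
    have hX : φ (X ^ p ^ r) = 0 := by
      rw [Ideal.Quotient.eq_zero_iff_dvd]
    rw [← map_pow, sub_pow_char_pow, one_pow, map_sub, hX, map_one, sub_zero]
  have h := two_mul_sum_qPoch hp.pow hq
  simp only [qPoch, one_mul] at h
  rw [map_sub, sub_eq_zero]
  have h2 : φ 2 = 2 := map_ofNat φ 2
  have h3 : φ 3 = 3 := map_ofNat φ 3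
  simpa [h2, h3] using h

lemma exists_int_secondPentagonal (k : ℕ) : ∃ m : ℤ, m * (3 * m - 1) / 2 = (secondPentagonal k : ℤ) := by
  refine ⟨-k, ?_⟩
  have h : (2 * secondPentagonal k : ℤ) = k * (3 * k + 1) := mod_cast two_mul_secondPentagonal k
  rw [show (-k : ℤ) * (3 * -k - 1) = 2 * secondPentagonal k by rw [h]; ring]
  omega

lemma exists_int_secondPentagonal_add (k : ℕ) :
    ∃ m : ℤ, m * (3 * m - 1) / 2 = ((secondPentagonal k + (2 * k + 1) : ℕ) : ℤ) := by
  refine ⟨k + 1, ?_⟩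
  have h : (2 * secondPentagonal k : ℤ) = k * (3 * k + 1) := mod_cast two_mul_secondPentagonal k
  rw [show (k + 1 : ℤ) * (3 * (k + 1) - 1) = 2 * (secondPentagonal k + (2 * k + 1)) by
    linear_combination -h]
  push_cast
  omega

/-- Main theorem: if p is prime and i lies in T(p) (i.e. 0 ≤ i ≤ p-1 and i is strictly
larger than every residue mod p of a generalized pentagonal number m(3m-1)/2),
then p divides ξ(pn+i) for all n. -/
theorem fishburn_congruence (p : ℕ) (hp : p.Prime) (i : ℕ) (hi : i ≤ p - 1)
    (hT : ∀ s : ℕ, s ≤ p - 1 →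
      (∃ m : ℤ, m * (3 * m - 1) / 2 ≡ (s : ℤ) [ZMOD p]) → s < i) :
    ∀ n : ℕ, (p : ℤ) ∣ fishburn (p * n + i) := by
  intro n
  have : Fact p.Prime := ⟨hp⟩
  have hodd : Odd p := by
    refine hp.odd_of_ne_two ?_
    rintro rfl
    have := hT 1 le_rfl ⟨1, by norm_num⟩
    omega
  have hp0 := hp.pos
  set N := p * n + i with hN
  have hNi : N % p = i := by
    rw [hN, Nat.mul_add_mod, Nat.mod_eq_of_lt (by omega)]
  have hlt {e : ℕ} (he : ∃ m : ℤ, m * (3 * m - 1) / 2 = (e : ℤ)) :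
      ((1 - X : (ZMod p)[X]) ^ e).coeff N = 0 := by
    apply coeff_one_sub_X_pow_eq_zero
    rw [hNi]
    obtain ⟨m, hm⟩ := he
    refine hT _ (Nat.le_pred_of_lt (Nat.mod_lt _ hp0)) ⟨m, ?_⟩
    rw [hm, Int.natCast_mod]
    exact (Int.mod_modEq _ _).symm
  have hNP : N < p ^ N := Nat.lt_pow_self hp.one_lt
  have h := X_pow_dvd_iff.mp (X_pow_dvd_two_mul_sum hodd N) N hNP
  have hsum : (∑ k ∈ range (p ^ N), (-1) ^ k *
      ((3 * (k : (ZMod p)[X]) + 2) * (1 - X) ^ (secondPentagonal k + (2 * k + 1))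
        - 3 * (k : (ZMod p)[X]) * (1 - X) ^ secondPentagonal k) : (ZMod p)[X]).coeff N = 0 := by
    rw [finsetSum_coeff]
    refine sum_eq_zero fun k _ => ?_
    have : ((-1) ^ k * ((3 * (k : (ZMod p)[X]) + 2) * (1 - X) ^ (secondPentagonal k + (2 * k + 1))
        - 3 * (k : (ZMod p)[X]) * (1 - X) ^ secondPentagonal k) : (ZMod p)[X]) =
        C ((-1) ^ k * (3 * (k : ZMod p) + 2)) * (1 - X) ^ (secondPentagonal k + (2 * k + 1))
        - C ((-1) ^ k * (3 * (k : ZMod p))) * (1 - X) ^ secondPentagonal k := by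
      simp only [C_mul, C_add, C_pow, C_neg, C_1, C_ofNat, C_eq_natCast]
      ring
    rw [this, coeff_sub, coeff_C_mul, coeff_C_mul, hlt (exists_int_secondPentagonal k),
      hlt (exists_int_secondPentagonal_add k), mul_zero, mul_zero, sub_zero]
  rw [coeff_sub, hsum, sub_zero, ← C_ofNat, coeff_C_mul, coeff_sum_eq_of_le hNP] at h
  have h2 : (2 : ZMod p) ≠ 0 := by
    have := (ZMod.natCast_eq_zero_iff 2 p).not.mpr fun hd => by
      have := (Nat.prime_dvd_prime_iff_eq hp Nat.prime_two).mp hd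
      rw [this] at hodd
      exact absurd hodd (by decide)
    exact_mod_cast this
  have h0 := (mul_eq_zero.mp h).resolve_left h2
  rw [← ZMod.intCast_zmod_eq_zero_iff_dvd, fishburn, ← eq_intCast (Int.castRingHom (ZMod p)),
    ← coeff_map, ← h0]
  simp [Polynomial.map_sum, Polynomial.map_prod]
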